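/- Let n ≥ 1 and d ≥ 1, let X ⊂ ℝ^d be nonempty, compact and convex with M = sup{‖x‖ : x ∈ X}, let σ > 0, and for i ∈ {1,…,n} let f^i : ℝ^d → ℝ be differentiable and σ-strongly convex on X with ‖∇f^i(x)‖ ≤ L on X. Let x̄, x* ∈ X, let π, z ∈ ℝ^n with π stochastic, ξ₁^{-1} ≤ z[i] for all i with ξ₁ > 0, and |π[i] − z[i]| ≤ δ for all i and some δ ≥ 0. Then Σ_{i=1}^n (π[i]/z[i]) ⟨∇f^i(x̄), x* − x̄⟩ ≤ Σ_{i=1}^n [f^i(x*) − f^i(x̄) − (σ/2)‖x̄ − x*‖²] + 2MnLξ₁δ. -/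

import Mathlib

/-- For σ-strongly convex differentiable functions `f^i` on a nonempty
compact convex set `X` with `M = sup{‖x‖ : x ∈ X}` and gradients bounded by `L`, a
stochastic vector `π`, a vector `z` with `z[i] ≥ ξ₁⁻¹` and `|π[i] − z[i]| ≤ δ`, and
`x̄, x* ∈ X`, one has
`∑_i (π[i]/z[i]) ⟨∇f^i(x̄), x* − x̄⟩
  ≤ ∑_i [f^i(x*) − f^i(x̄) − (σ/2)‖x̄ − x*‖²] + 2MnLξ₁δ`. -/
theorem stmt_12
    (n d : ℕ) (hn : 1 ≤ n) (hd : 1 ≤ d)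
    (X : Set (EuclideanSpace ℝ (Fin d)))
    (hXne : X.Nonempty) (hXcomp : IsCompact X) (hXconv : Convex ℝ X)
    (M σ L ξ₁ δ : ℝ)
    (hM : IsLUB ((fun x => ‖x‖) '' X) M)
    (hσ : 0 < σ) (hξ₁ : 0 < ξ₁) (hδ : 0 ≤ δ)
    (f : Fin n → EuclideanSpace ℝ (Fin d) → ℝ)
    (hdiff : ∀ i, ∀ x ∈ X, DifferentiableAt ℝ (f i) x)
    (hsc : ∀ i, ∀ x ∈ X, ∀ w ∈ X,
      f i w - f i x ≥ @inner ℝ _ _ (gradient (f i) x) (w - x) + σ / 2 * ‖w - x‖ ^ 2)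
    (hL : ∀ i, ∀ x ∈ X, ‖gradient (f i) x‖ ≤ L)
    (xbar xstar : EuclideanSpace ℝ (Fin d)) (hxbar : xbar ∈ X) (hxstar : xstar ∈ X)
    (π z : Fin n → ℝ)
    (hπ0 : ∀ i, 0 ≤ π i) (hπ1 : ∑ i, π i = 1)
    (hz : ∀ i, ξ₁⁻¹ ≤ z i) (hπz : ∀ i, |π i - z i| ≤ δ) :
    ∑ i, (π i / z i) * @inner ℝ _ _ (gradient (f i) xbar) (xstar - xbar)
      ≤ (∑ i, (f i xstar - f i xbar - σ / 2 * ‖xbar - xstar‖ ^ 2))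
        + 2 * M * n * L * ξ₁ * δ := by
  have key : ∀ i, (π i / z i) * @inner ℝ _ _ (gradient (f i) xbar) (xstar - xbar)
      ≤ (f i xstar - f i xbar - σ / 2 * ‖xbar - xstar‖ ^ 2) + 2 * M * L * ξ₁ * δ := by
    intro i
    have h1 := hsc i xbar hxbar xstar hxstar
    rw [norm_sub_rev xstar xbar] at h1
    have hMb : ‖xbar‖ ≤ M := hM.1 ⟨xbar, hxbar, rfl⟩
    have hMs : ‖xstar‖ ≤ M := hM.1 ⟨xstar, hxstar, rfl⟩
    have hn2 : ‖xstar - xbar‖ ≤ 2 * M := (norm_sub_le _ _).trans (by linarith)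
    have hLi := hL i xbar hxbar
    have hL0 : 0 ≤ L := (norm_nonneg _).trans hLi
    have hg : |@inner ℝ _ _ (gradient (f i) xbar) (xstar - xbar)| ≤ L * (2 * M) :=
      (abs_real_inner_le_norm _ _).trans
        (mul_le_mul hLi hn2 (norm_nonneg _) hL0)
    have hzp : 0 < z i := (inv_pos.mpr hξ₁).trans_le (hz i)
    have hzi : (z i)⁻¹ ≤ ξ₁ := inv_le_of_inv_le₀ hξ₁ (hz i)
    have hc : |(π i - z i) * (z i)⁻¹| ≤ δ * ξ₁ := by
      rw [abs_mul, abs_of_pos (inv_pos.mpr hzp)]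
      exact mul_le_mul (hπz i) hzi (inv_pos.mpr hzp).le hδ
    set g := @inner ℝ _ _ (gradient (f i) xbar) (xstar - xbar) with hgdef
    have he : π i / z i * g = g + (π i - z i) * (z i)⁻¹ * g := by
      field_simp
      ring
    have hp : (π i - z i) * (z i)⁻¹ * g ≤ δ * ξ₁ * (L * (2 * M)) := by
      refine (le_abs_self _).trans ?_
      rw [abs_mul]
      exact mul_le_mul hc hg (abs_nonneg _) (mul_nonneg hδ hξ₁.le)
    rw [he]
    linarith
  refine (Finset.sum_le_sum fun i _ => key i).trans (le_of_eq ?_)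
  rw [Finset.sum_add_distrib]
  simp only [Finset.sum_const, Finset.card_univ, Fintype.card_fin, nsmul_eq_mul]
  ring
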